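/- For every k ≥ 2, the prediction number 𝔳^g_k equals the smallest cardinality of a family 𝒯 of k-trees (subtrees of the set of finite sequences of natural numbers) such that every function f : ℕ → ℕ is a branch of some tree in 𝒯. -/

import Mathlib

/-- A tree: a set of finite sequences of naturals closed under initial segments. -/
def IsTree (T : Set (List ℕ)) : Prop :=
  ∀ σ ∈ T, ∀ n : ℕ, σ.take n ∈ T

/-- The immediate successors of a node `σ` within `T`. -/
def succs (T : Set (List ℕ)) (σ : List ℕ) : Set ℕ :=
  {m : ℕ | σ ++ [m] ∈ T}

/-- A `k`-tree: a tree in which every node has at least `1` and at most `k`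
immediate successors. -/
def IsKTree (k : ℕ) (T : Set (List ℕ)) : Prop :=
  IsTree T ∧ ∀ σ ∈ T, 1 ≤ (succs T σ).encard ∧ (succs T σ).encard ≤ k

/-- The initial segment `f↾n = ⟨f 0, …, f (n-1)⟩`. -/
def seg (f : ℕ → ℕ) (n : ℕ) : List ℕ :=
  List.ofFn fun i : Fin n => f i

/-- `f` is a branch of `T` if all its finite initial segments belong to `T`. -/
def IsBranch (T : Set (List ℕ)) (f : ℕ → ℕ) : Prop :=
  ∀ n : ℕ, seg f n ∈ T

/-- A `k` globally adaptive predictor: a sequence `⟨π_n : n ∈ ℕ⟩` of functions,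
where `π_n` assigns to each sequence `s ∈ ℕ^n` a `k`-element set of naturals. -/
structure Predictor (k : ℕ) where
  π : (n : ℕ) → (Fin n → ℕ) → Finset ℕ
  card_π : ∀ n s, (π n s).card = k

/-- `f` is predicted by `p` if from some point on, `f n ∈ π_n (f↾n)`. -/
def Predicts {k : ℕ} (p : Predictor k) (f : ℕ → ℕ) : Prop :=
  ∃ m : ℕ, ∀ n : ℕ, m < n → f n ∈ p.π n fun i : Fin n => f i

/-- The prediction number `𝔳^g_k`: the smallest cardinality of a set of `k`
globally adaptive predictors predicting every `f : ℕ → ℕ`. -/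
noncomputable def predNum (k : ℕ) : Cardinal :=
  sInf {c : Cardinal | ∃ P : Set (Predictor k), Cardinal.mk P = c ∧
    ∀ f : ℕ → ℕ, ∃ p ∈ P, Predicts p f}

theorem length_seg (f : ℕ → ℕ) (n : ℕ) : (seg f n).length = n := by simp [seg]

theorem getElem_seg (f : ℕ → ℕ) (n i : ℕ) (h : i < (seg f n).length) : (seg f n)[i] = f i := by
  simp [seg]

theorem take_seg (f : ℕ → ℕ) {i n : ℕ} (h : i ≤ n) : (seg f n).take i = seg f i := by
  apply List.ext_getElem
  · simp [length_seg, h]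
  · simp [getElem_seg]

theorem seg_succ (f : ℕ → ℕ) (n : ℕ) : seg f (n + 1) = seg f n ++ [f n] := by
  simp only [seg, List.ofFn_succ_last, Fin.val_castSucc, Fin.val_last]

/-- The tree of sequences each of whose entries is allowed by `A`, given the preceding entries. -/
def treeOf (A : List ℕ → Set ℕ) : Set (List ℕ) :=
  {σ | ∀ i (h : i < σ.length), σ[i] ∈ A (σ.take i)}

theorem isTree_treeOf (A : List ℕ → Set ℕ) : IsTree (treeOf A) := by
  intro σ hσ n i hi
  obtain ⟨hin, hiσ⟩ : i < n ∧ i < σ.length := by simpa using hi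
  simpa [List.take_take, hin.le] using hσ i hiσ

theorem succs_treeOf {A : List ℕ → Set ℕ} {σ : List ℕ} (hσ : σ ∈ treeOf A) :
    succs (treeOf A) σ = A σ := by
  ext m
  constructor
  · intro h
    simpa using h σ.length (by simp)
  · intro h i hi
    rcases Nat.lt_or_ge i σ.length with hlt | hge
    · simpa [List.getElem_append_left hlt, List.take_append_of_le_length hlt.le] using hσ i hlt
    · obtain rfl : i = σ.length := by
        simp only [List.length_append, List.length_singleton] at hi
        omega
      simpa using h

theorem isKTree_treeOf {k : ℕ} {A : List ℕ → Set ℕ}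
    (hA : ∀ σ, 1 ≤ (A σ).encard ∧ (A σ).encard ≤ k) : IsKTree k (treeOf A) :=
  ⟨isTree_treeOf A, fun σ hσ => by rw [succs_treeOf hσ]; exact hA σ⟩

theorem isBranch_treeOf {A : List ℕ → Set ℕ} {f : ℕ → ℕ} (h : ∀ n, f n ∈ A (seg f n)) :
    IsBranch (treeOf A) f := by
  intro n i hi
  have hin : i ≤ n := by rw [length_seg] at hi; exact hi.le
  rw [getElem_seg, take_seg f hin]
  exact h i

/-- The values allowed after `σ` when following `s` for as long as it lasts and the predictor `p`
from then on. -/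
def Predictor.allowed {k : ℕ} (p : Predictor k) (s σ : List ℕ) : Set ℕ :=
  if σ.length < s.length then {s.getD σ.length 0}
  else p.π σ.length fun i : Fin σ.length => σ.getD i 0

theorem Predictor.encard_allowed {k : ℕ} (hk : 1 ≤ k) (p : Predictor k) (s σ : List ℕ) :
    1 ≤ (p.allowed s σ).encard ∧ (p.allowed s σ).encard ≤ k := by
  unfold Predictor.allowed
  split_ifs
  · simpa using hk
  · simpa [Set.encard_coe_eq_coe_finsetCard, p.card_π] using hk

theorem Predictor.isBranch_treeOf_allowed {k m : ℕ} {p : Predictor k} {f : ℕ → ℕ}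
    (h : ∀ n : ℕ, m < n → f n ∈ p.π n fun i : Fin n => f i) :
    IsBranch (treeOf (p.allowed (seg f (m + 1)))) f := by
  refine isBranch_treeOf fun n => ?_
  unfold Predictor.allowed
  rw [length_seg, length_seg]
  split_ifs with hn
  · simp [length_seg, getElem_seg, hn]
  · have key : (fun i : Fin n => (seg f n).getD i 0) = fun i : Fin n => f i := by
      funext i
      rw [List.getD_eq_getElem _ _ (by simp [length_seg]), getElem_seg]
    rw [key]
    exact h n (by omega)

theorem IsKTree.exists_predictor {k : ℕ} {T : Set (List ℕ)} (hT : IsKTree k T) :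
    ∃ p : Predictor k, ∀ f, IsBranch T f → Predicts p f := by
  have key : ∀ (n : ℕ) (s : Fin n → ℕ), ∃ F : Finset ℕ, F.card = k ∧
      (List.ofFn s ∈ T → succs T (List.ofFn s) ⊆ F) := by
    intro n s
    by_cases hs : List.ofFn s ∈ T
    · have hle := (hT.2 _ hs).2
      have hfin := Set.finite_of_encard_le_coe hle
      rw [hfin.encard_eq_coe_toFinset_card, Nat.cast_le] at hle
      obtain ⟨F, hF, hcard⟩ := Infinite.exists_superset_card_eq hfin.toFinset k hle
      exact ⟨F, hcard, fun _ x hx => hF (hfin.mem_toFinset.2 hx)⟩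
    · exact ⟨Finset.range k, Finset.card_range k, fun h => absurd h hs⟩
  choose F hcard hF using key
  refine ⟨⟨F, hcard⟩, fun f hf => ⟨0, fun n _ => hF n _ (hf n) ?_⟩⟩
  have hsucc := hf (n + 1)
  rwa [seg_succ] at hsucc

theorem infinite_of_forall_exists_predicts {k : ℕ} {P : Set (Predictor k)}
    (hP : ∀ f : ℕ → ℕ, ∃ p ∈ P, Predicts p f) : P.Infinite := by
  intro hfin
  have key : ∀ (n : ℕ) (s : Fin n → ℕ), ∃ a : ℕ, ∀ p ∈ P, a ∉ p.π n s := by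
    intro n s
    obtain ⟨a, ha⟩ := (hfin.toFinset.biUnion fun p => p.π n s).exists_notMem
    refine ⟨a, fun p hp hap => ha ?_⟩
    exact Finset.mem_biUnion.2 ⟨p, hfin.mem_toFinset.2 hp, hap⟩
  choose a ha using key
  let f : ℕ → ℕ := WellFounded.fix Nat.lt_wfRel.wf fun n ih => a n fun i => ih i i.isLt
  have hf : ∀ n, f n = a n fun i : Fin n => f i := fun n => WellFounded.fix_eq _ _ _
  obtain ⟨p, hp, m, hm⟩ := hP f
  apply ha (m + 1) (fun i => f i) p hp
  rw [← hf]
  exact hm (m + 1) m.lt_succ_self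

theorem stmt7 (k : ℕ) (hk : 2 ≤ k) :
    predNum k =
      sInf {c : Cardinal | ∃ 𝒯 : Set (Set (List ℕ)), Cardinal.mk 𝒯 = c ∧
        (∀ T ∈ 𝒯, IsKTree k T) ∧ ∀ f : ℕ → ℕ, ∃ T ∈ 𝒯, IsBranch T f} := by
  refine csInf_eq_csInf_of_forall_exists_le ?_ ?_
  · rintro _ ⟨P, rfl, hP⟩
    let g : P × List ℕ → Set (List ℕ) := fun x => treeOf (x.1.val.allowed x.2)
    refine ⟨_, ⟨Set.range g, rfl, ?_, fun f => ?_⟩, ?_⟩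
    · rintro _ ⟨x, rfl⟩
      exact isKTree_treeOf (x.1.val.encard_allowed (by omega) x.2)
    · obtain ⟨p, hp, m, hm⟩ := hP f
      exact ⟨_, ⟨(⟨p, hp⟩, seg f (m + 1)), rfl⟩, Predictor.isBranch_treeOf_allowed hm⟩
    · have : Infinite P := (infinite_of_forall_exists_predicts hP).to_subtype
      refine Cardinal.mk_range_le.trans (le_of_eq ?_)
      rw [Cardinal.mk_prod, Cardinal.lift_id, Cardinal.lift_id, Cardinal.mk_eq_aleph0 (List ℕ)]
      exact Cardinal.mul_aleph0_eq (Cardinal.aleph0_le_mk P)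
  · rintro _ ⟨𝒯, rfl, hT, hcov⟩
    choose p hp using fun T : 𝒯 => (hT T T.2).exists_predictor
    refine ⟨_, ⟨Set.range p, rfl, fun f => ?_⟩, Cardinal.mk_range_le⟩
    obtain ⟨T, hmem, hf⟩ := hcov f
    exact ⟨_, ⟨⟨T, hmem⟩, rfl⟩, hp _ f hf⟩
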